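/- Let $\sigma_t : \mathbb{R}^d \to \mathbb{R}^+$, $\nu_t : \mathbb{R}^d \to \mathbb{R}^+$ and $\alpha_t : \mathbb{R}^d \to PD_d(\mathbb{R})$ be arbitrary maps, and set $\alpha_{st} = (\alpha_s + \alpha_t)/2$, $\nu_{st} = (\nu_s + \nu_t)/2$. Then the function $R(s,t) = \sigma_s \sigma_t \det(\alpha_{st}^{-1/2})\, \mathcal{M}_{\nu_{st}}\bigl(|\alpha_{st}^{-1/2}(s - t)|\bigr)$, where $\mathcal{M}_\nu(x) = x^\nu \mathcal{K}_\nu(x)$ for $x > 0$ (extended continuously at $x = 0$), is a positive semidefinite kernel on $\mathbb{R}^d$. -/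

import Mathlib

open Matrix Real MeasureTheory

/-- The modified Bessel function of the second kind of order `ν`, defined by the
standard integral representation `K_ν(z) = ∫_0^∞ e^{-z cosh u} cosh(ν u) du`. -/
noncomputable def besselK (ν z : ℝ) : ℝ :=
  ∫ u in Set.Ioi (0 : ℝ), Real.exp (-z * Real.cosh u) * Real.cosh (ν * u)

/-- `M_ν(x) = x^ν K_ν(x)` for `x > 0`, extended continuously at `x = 0` by its limit
`2^{ν-1} Γ(ν)`. -/
noncomputable def maternM (ν x : ℝ) : ℝ :=
  if x = 0 then 2 ^ (ν - 1) * Real.Gamma ν else x ^ ν * besselK ν x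

lemma mat_integrable (ν : ℝ) (hν : 0 < ν) (q : ℝ) (hq : 0 ≤ q) :
    IntegrableOn (fun v : ℝ => v ^ (ν - 1) * Real.exp (-v / 2) * Real.exp (-(q / (2 * v))))
      (Set.Ioi 0) := by
  have h1 : IntegrableOn (fun v : ℝ => v ^ (ν - 1) * Real.exp (-v / 2)) (Set.Ioi 0) := by
    have := integrableOn_rpow_mul_exp_neg_mul_rpow (p := 1) (s := ν - 1) (b := 1/2)
      (by linarith) (by norm_num) (by norm_num)
    refine this.congr_fun (fun v hv => ?_) measurableSet_Ioi
    simp only [Real.rpow_one]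
    congr 2; ring
  refine Integrable.mono' h1 ?_ ?_
  · exact (by fun_prop : Measurable _).aestronglyMeasurable
  · refine (ae_restrict_iff' measurableSet_Ioi).2 (Filter.Eventually.of_forall fun v hv => ?_)
    have hv : 0 < v := hv
    rw [Real.norm_of_nonneg (by positivity)]
    refine mul_le_of_le_one_right (by positivity) (Real.exp_le_one_iff.2 ?_)
    have : 0 ≤ q / (2 * v) := by positivity
    linarith

lemma mat_repr (ν : ℝ) (hν : 0 < ν) (x : ℝ) (hx : 0 ≤ x) :
    maternM ν x = (1/2) * ∫ v in Set.Ioi (0:ℝ),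
      v ^ (ν - 1) * Real.exp (-v / 2) * Real.exp (-(x^2 / (2 * v))) := by
  have hI := mat_integrable ν hν (x^2) (by positivity)
  rcases hx.eq_or_lt with h0 | hx
  · subst h0
    have := Real.integral_rpow_mul_exp_neg_mul_Ioi hν (r := 1/2) (by norm_num)
    have h2 : ∫ v in Set.Ioi (0:ℝ),
      v ^ (ν - 1) * Real.exp (-v / 2) * Real.exp (-((0:ℝ)^2 / (2 * v))) = 
      ∫ t in Set.Ioi (0:ℝ), t ^ (ν - 1) * Real.exp (-(1/2 * t)) := by
      congr 1; ext v; simp; left; ring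
    rw [h2, this, maternM, if_pos rfl, Real.rpow_sub (by norm_num), Real.rpow_one]
    norm_num; ring
  · have him : (fun u : ℝ => x * Real.exp u) '' Set.univ = Set.Ioi 0 := by
      ext v; simp only [Set.mem_image, Set.mem_univ, true_and, Set.mem_Ioi]
      constructor
      · rintro ⟨u, rfl⟩; positivity
      · intro hv; exact ⟨Real.log (v / x), by rw [Real.exp_log (by positivity)]; field_simp⟩
    have hd : ∀ u ∈ Set.univ, HasDerivWithinAt (fun u : ℝ => x * Real.exp u) (x * Real.exp u) Set.univ u :=
      fun u _ => ((Real.hasDerivAt_exp u).const_mul x).hasDerivWithinAt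
    have hinj : Set.InjOn (fun u : ℝ => x * Real.exp u) Set.univ := by
      intro a _ b _ h
      exact Real.exp_injective (mul_left_cancel₀ hx.ne' h)
    have key : ∀ u : ℝ, |x * Real.exp u| • ((x * Real.exp u) ^ (ν - 1) * Real.exp (-(x * Real.exp u) / 2) * Real.exp (-(x^2 / (2 * (x * Real.exp u))))) = x ^ ν * (Real.exp (-x * Real.cosh u) * Real.exp (ν * u)) := by
      intro u
      have hp : 0 < x * Real.exp u := by positivity
      rw [abs_of_pos hp, smul_eq_mul, Real.rpow_sub hp, Real.rpow_one, mul_assoc (_ / _),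
        ← Real.exp_add, Real.mul_rpow hx.le (Real.exp_pos u).le, ← Real.exp_mul, Real.cosh_eq,
        Real.exp_neg]
      have : -(x * Real.exp u) / 2 + -(x^2 / (2 * (x * Real.exp u))) = -x * ((Real.exp u + (Real.exp u)⁻¹)/2) := by
        field_simp
        ring
      rw [this, mul_comm u ν]
      field_simp
    have h1 := integral_image_eq_integral_abs_deriv_smul MeasurableSet.univ hd hinj (fun v : ℝ =>
      v ^ (ν - 1) * Real.exp (-v / 2) * Real.exp (-(x^2 / (2 * v))))
    have h2 := (integrableOn_image_iff_integrableOn_abs_deriv_smul MeasurableSet.univ hd hinj (fun v : ℝ =>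
      v ^ (ν - 1) * Real.exp (-v / 2) * Real.exp (-(x^2 / (2 * v)))))
    rw [him] at h1 h2
    have h3 := h2.1 hI
    simp only [key] at h1 h3
    rw [h1, maternM, if_neg hx.ne', integral_const_mul]
    have h4 : Integrable (fun u : ℝ => Real.exp (-x * Real.cosh u) * Real.exp (ν * u)) := by
      rw [integrableOn_univ] at h3
      have := h3.const_mul (x ^ ν)⁻¹
      refine this.congr (Filter.Eventually.of_forall fun u => ?_)
      have : x ^ ν ≠ 0 := (Real.rpow_pos_of_pos hx ν).ne'
      simp only
      field_simp
    have h5 := h4.comp_neg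
    rw [setIntegral_univ, ← intervalIntegral.integral_Iic_add_Ioi (b := (0:ℝ)) h4.integrableOn h4.integrableOn]
    have h6 := integral_comp_neg_Ioi (0:ℝ) (fun u : ℝ => Real.exp (-x * Real.cosh u) * Real.exp (ν * u))
    rw [neg_zero] at h6
    rw [← h6, ← integral_add h5.integrableOn h4.integrableOn, besselK]
    rw [mul_left_comm, ← integral_const_mul (1 / 2 : ℝ)]
    congr 1
    refine setIntegral_congr_fun measurableSet_Ioi fun u _ => ?_
    rw [Real.cosh_neg, Real.cosh_eq (ν * u), mul_neg]
    ring

lemma gauss_fourier {d : ℕ} (A B : Matrix (Fin d) (Fin d) ℝ) (hB : B.PosDef)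
    (hAB : B * A * B = 1) (v : ℝ) (hv : 0 < v) (z : Fin d → ℝ) :
    Integrable (fun ξ : Fin d → ℝ => Real.exp (-(v / 2) * (ξ ⬝ᵥ A *ᵥ ξ)) * Real.cos (ξ ⬝ᵥ z)) ∧
    ∫ ξ : Fin d → ℝ, Real.exp (-(v / 2) * (ξ ⬝ᵥ A *ᵥ ξ)) * Real.cos (ξ ⬝ᵥ z) =
      (2 * π / v) ^ ((d : ℝ) / 2) * (B.det * Real.exp (-((∑ i, (B *ᵥ z) i ^ 2) / (2 * v)))) := by
  have hdet := hB.det_pos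
  have hBt : Bᵀ = B := by
    have := hB.isHermitian.eq
    rwa [conjTranspose_eq_transpose_of_trivial] at this
  set g : (Fin d → ℝ) → ℝ :=
    fun ξ => Real.exp (-(v / 2) * (ξ ⬝ᵥ A *ᵥ ξ)) * Real.cos (ξ ⬝ᵥ z) with hg
  have hgc : Continuous g := by
    rw [hg]
    have h1 : Continuous fun ξ : Fin d → ℝ => ξ ⬝ᵥ A *ᵥ ξ :=
      continuous_id.dotProduct (continuous_const.matrix_mulVec continuous_id)
    have h2 : Continuous fun ξ : Fin d → ℝ => ξ ⬝ᵥ z := continuous_id.dotProduct continuous_const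
    fun_prop
  have hb : 0 < ((v / 2 : ℝ) : ℂ).re := by simpa using hv
  have hI := GaussianFourier.integrable_cexp_neg_mul_sum_add hb
    (fun i : Fin d => Complex.I * ((B *ᵥ z) i : ℂ))
  have hE := GaussianFourier.integral_cexp_neg_mul_sum_add hb
    (fun i : Fin d => Complex.I * ((B *ᵥ z) i : ℂ))
  have hgB : ∀ η : Fin d → ℝ, g (toLin' B η) = (Complex.exp (-((v / 2 : ℝ) : ℂ) * ∑ i, (η i : ℂ) ^ 2
      + ∑ i, Complex.I * ((B *ᵥ z) i : ℂ) * η i)).re := by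
    intro η
    have e1 : (-((v / 2 : ℝ) : ℂ) * ∑ i, (η i : ℂ) ^ 2
      + ∑ i, Complex.I * ((B *ᵥ z) i : ℂ) * η i) = ((-(v / 2) * ∑ i, η i ^ 2 : ℝ) : ℂ)
        + ((η ⬝ᵥ B *ᵥ z : ℝ) : ℂ) * Complex.I := by
      simp only [dotProduct]
      push_cast
      rw [Finset.sum_mul]
      congr 1
      exact Finset.sum_congr rfl fun i _ => by ring
    have e2 : (B *ᵥ η) ⬝ᵥ A *ᵥ (B *ᵥ η) = ∑ i, η i ^ 2 := by
      rw [mulVec_mulVec, ← vecMul_transpose, hBt, ← dotProduct_mulVec, mulVec_mulVec,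
        ← mul_assoc, hAB, one_mulVec]
      simp only [dotProduct, sq]
    have e3 : (B *ᵥ η) ⬝ᵥ z = η ⬝ᵥ B *ᵥ z := by
      rw [← vecMul_transpose, hBt, ← dotProduct_mulVec]
    rw [e1, Complex.exp_add, ← Complex.ofReal_exp, Complex.re_ofReal_mul,
      Complex.exp_ofReal_mul_I_re]
    simp only [hg, toLin'_apply, e2, e3]
  have hmap := Real.map_matrix_volume_pi_eq_smul_volume_pi hdet.ne'
  have hme : AEMeasurable (toLin' B) (volume : Measure (Fin d → ℝ)) :=
    (LinearMap.continuous_of_finiteDimensional (toLin' B)).measurable.aemeasurable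
  have hc0 : ENNReal.ofReal (abs (B.det)⁻¹) ≠ 0 := by
    simp [hdet.ne']
  have hInt : Integrable g := by
    have : Integrable g (Measure.map (toLin' B) volume) := by
      rw [integrable_map_measure hgc.aestronglyMeasurable hme]
      exact hI.re.congr (Filter.Eventually.of_forall fun η => (hgB η).symm)
    rw [hmap] at this
    exact (integrable_smul_measure hc0 ENNReal.ofReal_ne_top).1 this
  refine ⟨hInt, ?_⟩
  have h1 : ∫ ξ, g ξ ∂(Measure.map (toLin' B) volume) = ∫ η, g (toLin' B η) :=
    integral_map hme hgc.aestronglyMeasurable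
  rw [hmap, integral_smul_measure, ENNReal.toReal_ofReal (abs_nonneg _), abs_of_pos (by positivity),
    smul_eq_mul] at h1
  simp only [hgB] at h1
  have h2 := integral_re hI
  simp only [RCLike.re_to_complex] at h2
  rw [h2, hE] at h1
  have e4 : ((π : ℂ) / ((v / 2 : ℝ) : ℂ)) ^ ((Fintype.card (Fin d) : ℂ) / 2) *
      Complex.exp ((∑ i, (Complex.I * ((B *ᵥ z) i : ℂ)) ^ 2) / (4 * ((v / 2 : ℝ) : ℂ))) =
      (((2 * π / v) ^ ((d : ℝ) / 2) * Real.exp (-((∑ i, (B *ᵥ z) i ^ 2) / (2 * v))) : ℝ) : ℂ) := by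
    rw [Complex.ofReal_mul, Complex.ofReal_exp, Complex.ofReal_cpow (by positivity)]
    congr 2
    · push_cast; field_simp
    · simp
    · simp only [mul_pow, Complex.I_sq, neg_mul, one_mul, Finset.sum_neg_distrib]
      push_cast
      rw [neg_div]
      congr 2; ring
  rw [e4, Complex.ofReal_re] at h1
  field_simp at h1
  rw [h1]; ring

lemma kernel_psd {d m : ℕ} (A : Fin m → Matrix (Fin d) (Fin d) ℝ)
    (B : Fin m → Fin m → Matrix (Fin d) (Fin d) ℝ) (hB : ∀ i j, (B i j).PosDef)
    (hAB : ∀ i j, B i j * ((1 / 2 : ℝ) • (A i + A j)) * B i j = 1) (v : ℝ) (hv : 0 < v)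
    (x : Fin m → Fin d → ℝ) (a : Fin m → ℝ) :
    0 ≤ ∑ i, ∑ j, a i * a j * ((B i j).det *
      Real.exp (-((∑ k, (B i j *ᵥ (x i - x j)) k ^ 2) / (2 * v)))) := by
  have hG := fun i j => gauss_fourier _ _ (hB i j) (hAB i j) v hv (x i - x j)
  have hc : 0 < (2 * π / v) ^ ((d : ℝ) / 2) := by positivity
  refine nonneg_of_mul_nonneg_right (a := (2 * π / v) ^ ((d : ℝ) / 2)) ?_ hc
  have : (2 * π / v) ^ ((d : ℝ) / 2) * (∑ i, ∑ j, a i * a j * ((B i j).det *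
      Real.exp (-((∑ k, (B i j *ᵥ (x i - x j)) k ^ 2) / (2 * v))))) =
      ∫ ξ : Fin d → ℝ, ∑ i, ∑ j, a i * a j * (Real.exp (-(v / 2) *
        (ξ ⬝ᵥ ((1 / 2 : ℝ) • (A i + A j)) *ᵥ ξ)) * Real.cos (ξ ⬝ᵥ (x i - x j))) := by
    rw [integral_finsetSum _ fun i _ => integrable_finsetSum _ fun j _ => (hG i j).1.const_mul _,
      Finset.mul_sum]
    refine Finset.sum_congr rfl fun i _ => ?_
    rw [integral_finsetSum _ fun j _ => (hG i j).1.const_mul _, Finset.mul_sum]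
    refine Finset.sum_congr rfl fun j _ => ?_
    rw [integral_const_mul, (hG i j).2]
    ring
  rw [this]
  refine integral_nonneg fun ξ => ?_
  set p : Fin m → ℝ := fun i => a i * Real.exp (-(v / 4) * (ξ ⬝ᵥ A i *ᵥ ξ)) with hp
  have : ∑ i, ∑ j, a i * a j * (Real.exp (-(v / 2) *
        (ξ ⬝ᵥ ((1 / 2 : ℝ) • (A i + A j)) *ᵥ ξ)) * Real.cos (ξ ⬝ᵥ (x i - x j))) =
      (∑ i, p i * Real.cos (ξ ⬝ᵥ x i)) ^ 2 + (∑ i, p i * Real.sin (ξ ⬝ᵥ x i)) ^ 2 := by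
    rw [sq, sq, Finset.sum_mul_sum, Finset.sum_mul_sum, ← Finset.sum_add_distrib]
    refine Finset.sum_congr rfl fun i _ => ?_
    rw [← Finset.sum_add_distrib]
    refine Finset.sum_congr rfl fun j _ => ?_
    rw [dotProduct_sub, Real.cos_sub, smul_mulVec, add_mulVec, dotProduct_smul, dotProduct_add,
      smul_eq_mul]
    have : -(v / 2) * (1 / 2 * (ξ ⬝ᵥ A i *ᵥ ξ + ξ ⬝ᵥ A j *ᵥ ξ)) =
      -(v / 4) * (ξ ⬝ᵥ A i *ᵥ ξ) + -(v / 4) * (ξ ⬝ᵥ A j *ᵥ ξ) := by ring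
    rw [this, Real.exp_add]
    simp only [hp]
    ring
  simp only [Pi.zero_apply]
  rw [this]
  positivity

/-- The nonstationary local Matérn covariance
`R(s,t) = σ_s σ_t det(α_{st}^{-1/2}) M_{ν_{st}}(|α_{st}^{-1/2}(s-t)|)` with spatially
varying variance, smoothness and geometric anisotropy is a positive semidefinite
kernel on `ℝᵈ`.  Here `α_{st} = (α_s + α_t)/2`, `ν_{st} = (ν_s + ν_t)/2`, and
`α^{-1/2}` denotes the inverse positive definite square root of `α`. -/
theorem nonstationary_matern_posSemidef (d : ℕ)
    (σf νf : (Fin d → ℝ) → ℝ)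
    (hσf : ∀ x, 0 < σf x) (hνf : ∀ x, 0 < νf x)
    (α : (Fin d → ℝ) → Matrix (Fin d) (Fin d) ℝ)
    (hα : ∀ x, (α x).PosDef)
    (isq : Matrix (Fin d) (Fin d) ℝ → Matrix (Fin d) (Fin d) ℝ)
    (hisq : ∀ M : Matrix (Fin d) (Fin d) ℝ, M.PosDef →
      (isq M).PosDef ∧ isq M * isq M = M⁻¹)
    (R : (Fin d → ℝ) → (Fin d → ℝ) → ℝ)
    (hR : ∀ s t, R s t = σf s * σf t * (isq ((1 / 2 : ℝ) • (α s + α t))).det *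
      maternM ((νf s + νf t) / 2)
        (Real.sqrt (∑ i, ((isq ((1 / 2 : ℝ) • (α s + α t))).mulVec (s - t) i) ^ 2))) :
    ∀ (m : ℕ) (x : Fin m → (Fin d → ℝ)) (a : Fin m → ℝ),
      0 ≤ ∑ i, ∑ j, a i * a j * R (x i) (x j) := by
  intro m x a
  have hpd : ∀ i j, ((1 / 2 : ℝ) • (α (x i) + α (x j))).PosDef := fun i j =>
    ((hα _).add (hα _)).smul (by norm_num)
  set B : Fin m → Fin m → Matrix (Fin d) (Fin d) ℝ :=
    fun i j => isq ((1 / 2 : ℝ) • (α (x i) + α (x j))) with hBdef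
  have hB : ∀ i j, (B i j).PosDef := fun i j => (hisq _ (hpd i j)).1
  have hAB : ∀ i j, B i j * ((1 / 2 : ℝ) • (α (x i) + α (x j))) * B i j = 1 := by
    intro i j
    refine mul_eq_one_comm.1 ?_
    rw [← mul_assoc, (hisq _ (hpd i j)).2]
    exact nonsing_inv_mul _ (hpd i j).det_pos.ne'.isUnit
  set ν : Fin m → Fin m → ℝ := fun i j => (νf (x i) + νf (x j)) / 2 with hνdef
  have hν : ∀ i j, 0 < ν i j := fun i j => by
    have := hνf (x i); have := hνf (x j); simp only [hνdef]; linarith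
  set q : Fin m → Fin m → ℝ := fun i j => ∑ k, (B i j *ᵥ (x i - x j)) k ^ 2 with hqdef
  have hq : ∀ i j, 0 ≤ q i j := fun i j => Finset.sum_nonneg fun k _ => sq_nonneg _
  have hI := fun i j => mat_integrable (ν i j) (hν i j) (q i j) (hq i j)
  have hRR : ∀ i j, R (x i) (x j) = σf (x i) * σf (x j) * (B i j).det * ((1 / 2) *
      ∫ v in Set.Ioi (0:ℝ), v ^ (ν i j - 1) * Real.exp (-v / 2) *
        Real.exp (-(q i j / (2 * v)))) := by
    intro i j
    rw [hR, mat_repr _ (hν i j) _ (Real.sqrt_nonneg _), Real.sq_sqrt (hq i j)]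
  have hsum : ∑ i, ∑ j, a i * a j * R (x i) (x j) =
      ∫ v in Set.Ioi (0:ℝ), ∑ i, ∑ j, (a i * a j * (σf (x i) * σf (x j) * (B i j).det * (1 / 2))) *
        (v ^ (ν i j - 1) * Real.exp (-v / 2) * Real.exp (-(q i j / (2 * v)))) := by
    rw [integral_finsetSum _ fun i _ => integrable_finsetSum _ fun j _ => (hI i j).const_mul _]
    refine Finset.sum_congr rfl fun i _ => ?_
    rw [integral_finsetSum _ fun j _ => (hI i j).const_mul _]
    refine Finset.sum_congr rfl fun j _ => ?_
    rw [integral_const_mul, hRR]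
    ring
  rw [hsum]
  refine setIntegral_nonneg measurableSet_Ioi fun v hv => ?_
  have hv : 0 < v := hv
  have hk := kernel_psd (fun i => α (x i)) B hB hAB v hv x
    (fun i => a i * σf (x i) * v ^ (νf (x i) / 2))
  have hc : 0 ≤ (1 / 2) * Real.exp (-v / 2) / v := by positivity
  refine (mul_nonneg hc hk).trans_eq ?_
  rw [Finset.mul_sum]
  refine Finset.sum_congr rfl fun i _ => ?_
  rw [Finset.mul_sum]
  refine Finset.sum_congr rfl fun j _ => ?_
  have : v ^ (ν i j - 1) = v ^ (νf (x i) / 2) * v ^ (νf (x j) / 2) / v := by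
    rw [Real.rpow_sub hv, Real.rpow_one, ← Real.rpow_add hv]
    simp only [hνdef]
    congr 2; ring
  rw [this]
  simp only [hqdef]
  ring
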